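/- arXiv:0810.0484 — 12 statements merged into one kernel-verified Lean document; each statement's English description precedes it below -/
import Mathlib

section
/- Let A be a unital associative ℂ-algebra, σ : A → A an algebra automorphism, δ : A → A a σ-derivation, and τ : A → ℂ a σ-trace with τ ∘ δ = 0. Then for every non-negative integer i and all a, b ∈ A, τ(b · (σ⁻¹ ∘ (δ ∘ σ⁻¹)^i)(a)) = (−1)^i τ(a · δ^i(b)), where (δ ∘ σ⁻¹)^i denotes the i-fold composite of the map δ ∘ σ⁻¹. -/
/-- For a `σ`-trace `τ` with `τ ∘ δ = 0` and a `σ`-derivation `δ`,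
`τ (b * (σ⁻¹ ∘ (δ ∘ σ⁻¹)^[i]) a) = (-1)^i * τ (a * δ^[i] b)` for every `i : ℕ`. -/
theorem twisted_trace_iterate_identity
    {A : Type*} [Ring A] [Algebra ℂ A]
    (σ : A ≃ₐ[ℂ] A) (δ : A →ₗ[ℂ] A) (τ : A →ₗ[ℂ] ℂ)
    (hδ : ∀ a b : A, δ (a * b) = δ a * b + σ a * δ b)
    (hτ : ∀ a b : A, τ (a * b) = τ (σ b * a))
    (hτδ : ∀ a : A, τ (δ a) = 0) :
    ∀ (i : ℕ) (a b : A),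
      τ (b * σ.symm ((⇑δ ∘ ⇑σ.symm)^[i] a)) = (-1 : ℂ) ^ i * τ (a * (⇑δ)^[i] b) := by
  have twist (a b : A) : τ (b * σ.symm a) = τ (a * b) := by
    rw [hτ, AlgEquiv.apply_symm_apply]
  have by_parts (a b : A) : τ (δ (σ.symm a) * b) = -τ (a * δ b) := by
    have h := hτδ (σ.symm a * b)
    rw [hδ, map_add, AlgEquiv.apply_symm_apply] at h
    exact eq_neg_of_add_eq_zero_left h
  intro i a
  induction i with
  | zero => intro b; simp [twist]
  | succ i ih =>
    intro b
    rw [Function.iterate_succ_apply', Function.comp_apply, twist, by_parts, ← twist, ih,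
      Function.iterate_succ_apply, pow_succ]
    ring
end

section
/- Let A be a unital associative ℂ-algebra, σ : A → A an algebra automorphism, δ : A → A a σ-derivation, and τ : A → ℂ a σ-trace with τ ∘ δ = 0. Then for all a, b ∈ A and every m-tuple i = (i₁, …, i_m) of non-negative integers, τ(b · (σ⁻¹ ∘ (δ∘σ⁻¹)^{i₁}) ∘ (σ⁻¹ ∘ (δ∘σ⁻¹)^{i₂}) ∘ ⋯ ∘ (σ⁻¹ ∘ (δ∘σ⁻¹)^{i_m})(a)) = (−1)^{i₁+⋯+i_m} τ(a · (δ^{i_m} ∘ σ ∘ δ^{i_{m−1}} ∘ σ ∘ ⋯ ∘ σ ∘ δ^{i₁})(b)). -/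
open Function

/-- The composite `(g ∘ (d ∘ g)^[i₁]) ∘ (g ∘ (d ∘ g)^[i₂]) ∘ ⋯ ∘ (g ∘ (d ∘ g)^[i_m])`
associated to a list `[i₁, …, i_m]`. (In applications `g = σ⁻¹`, `d = δ`.) -/
def leftComp {A : Type*} (g d : A → A) : List ℕ → (A → A)
  | [] => id
  | i :: t => (g ∘ (d ∘ g)^[i]) ∘ leftComp g d t

/-- Auxiliary tail of the right composite. -/
def rightCompTail {A : Type*} (s d : A → A) : List ℕ → (A → A)
  | [] => id
  | i :: t => rightCompTail s d t ∘ d^[i] ∘ s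

/-- The composite `d^[i_m] ∘ s ∘ d^[i_{m-1}] ∘ ⋯ ∘ s ∘ d^[i₁]`
associated to a list `[i₁, …, i_m]`. (In applications `s = σ`, `d = δ`.) -/
def rightComp {A : Type*} (s d : A → A) : List ℕ → (A → A)
  | [] => id
  | i :: t => rightCompTail s d t ∘ d^[i]

theorem sigmaTrace_mul_symm_iterate
    {A : Type*} [Ring A] [Algebra ℂ A]
    (σ : A ≃ₐ[ℂ] A) (δ : A →ₗ[ℂ] A) (τ : A →ₗ[ℂ] ℂ)
    (hδ : ∀ a b : A, δ (a * b) = δ a * b + σ a * δ b)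
    (hτ : ∀ a b : A, τ (a * b) = τ (σ b * a))
    (hτδ : ∀ a : A, τ (δ a) = 0) (i : ℕ) (b c : A) :
    τ (b * σ.symm ((δ ∘ σ.symm)^[i] c)) = (-1 : ℂ) ^ i * τ (c * δ^[i] b) := by
  induction i generalizing b with
  | zero => simp [hτ b]
  | succ i ih =>
    have by_parts : ∀ x y : A, τ (δ (σ.symm x) * y) = -τ (x * δ y) := fun x y => by
      have h := hτδ (σ.symm x * y)
      rw [hδ, map_add, AlgEquiv.apply_symm_apply] at h
      exact eq_neg_of_add_eq_zero_left h
    rw [hτ, AlgEquiv.apply_symm_apply, iterate_succ_apply', comp_apply, by_parts,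
      iterate_succ_apply, pow_succ, mul_neg_one, neg_mul, ← ih, hτ (δ b),
      AlgEquiv.apply_symm_apply]

theorem sigmaTrace_leftComp_mul
    {A : Type*} [Ring A] [Algebra ℂ A]
    (σ : A ≃ₐ[ℂ] A) (δ : A →ₗ[ℂ] A) (τ : A →ₗ[ℂ] ℂ)
    (hδ : ∀ a b : A, δ (a * b) = δ a * b + σ a * δ b)
    (hτ : ∀ a b : A, τ (a * b) = τ (σ b * a))
    (hτδ : ∀ a : A, τ (δ a) = 0) (l : List ℕ) (a b : A) :
    τ (leftComp σ.symm δ l a * b) = (-1 : ℂ) ^ l.sum * τ (a * rightCompTail σ δ l b) := by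
  induction l generalizing b with
  | nil => simp [leftComp, rightCompTail]
  | cons i t ih =>
    simp only [leftComp, rightCompTail, comp_apply, List.sum_cons]
    rw [hτ, sigmaTrace_mul_symm_iterate σ δ τ hδ hτ hτδ, ih, pow_add, mul_assoc]

/-- Lemma 3.2 of the paper. For a `σ`-trace `τ` with `τ ∘ δ = 0` and a
`σ`-derivation `δ`, for any nonempty tuple `(i₁, …, i_m)` of non-negative integers,
`τ (b ⬝ (σ⁻¹(δσ⁻¹)^{i₁}) ∘ ⋯ ∘ (σ⁻¹(δσ⁻¹)^{i_m}) (a))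
  = (-1)^{i₁+⋯+i_m} τ (a ⬝ δ^{i_m} σ δ^{i_{m-1}} ⋯ σ δ^{i₁} (b))`. -/
theorem twisted_trace_multi_iterate_identity
    {A : Type*} [Ring A] [Algebra ℂ A]
    (σ : A ≃ₐ[ℂ] A) (δ : A →ₗ[ℂ] A) (τ : A →ₗ[ℂ] ℂ)
    (hδ : ∀ a b : A, δ (a * b) = δ a * b + σ a * δ b)
    (hτ : ∀ a b : A, τ (a * b) = τ (σ b * a))
    (hτδ : ∀ a : A, τ (δ a) = 0) :
    ∀ (l : List ℕ), l ≠ [] → ∀ a b : A,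
      τ (b * leftComp (⇑σ.symm) (⇑δ) l a)
        = (-1 : ℂ) ^ l.sum * τ (a * rightComp (⇑σ) (⇑δ) l b) := by
  intro l hl a b
  cases l with
  | nil => exact absurd rfl hl
  | cons i t =>
    simp only [leftComp, rightComp, comp_apply, List.sum_cons]
    rw [sigmaTrace_mul_symm_iterate σ δ τ hδ hτ hτδ,
      sigmaTrace_leftComp_mul σ δ τ hδ hτ hτδ, pow_add, mul_assoc]
end

section
/- Let A be a unital associative ℂ-algebra, σ : A → A an algebra automorphism, δ : A → A a σ-derivation, and τ : A → ℂ a σ-trace with τ ∘ δ = 0. Let n ≥ 0 and p ≥ 1 be integers with k := n − p + 1 ≥ 0. Then for all a, b ∈ A, τ(a · P_{p−1, n}(σ, δ)(b)) = (−1)^k · Σ_{i ∈ ℕ^p, i₁+⋯+i_p = k} τ(b · (σ⁻¹ ∘ (δ∘σ⁻¹)^{i₁}) ∘ ⋯ ∘ (σ⁻¹ ∘ (δ∘σ⁻¹)^{i_p})(a)). (This is the identity res(a ξⁿ b ξ^{−p}) = res(b ξ^{−p} a ξⁿ) expressed at the level of coefficients, showing the noncommutative residue res(Σ aᵢ ξ^i)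 = τ(a₋₁) is a trace on the algebra of formal twisted pseudodifferential symbols.) -/
open Function

/-- The composite map associated to a word in two letters: `true` stands for `s`
and `false` stands for `d`, the first letter of the list acting last (outermost). -/
def wordMap {A : Type*} (s d : A → A) (w : List Bool) : A → A :=
  w.foldr (fun b f => (if b then s else d) ∘ f) id

/-- `Pmap s d i n` is `P_{i,n}(s,d)`: the sum, over all words of length `n` in the two
letters `s` and `d` containing exactly `i` occurrences of `s`, of the corresponding
composite map.  E.g. `P_{3,4}(σ,δ) = δσ³ + σδσ² + σ²δσ + σ³δ`. -/
noncomputable def Pmap {A : Type*} [AddCommMonoid A] (s d : A → A) (i n : ℕ) : A → A :=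
  ∑ w ∈ Finset.univ.filter (fun w : Fin n → Bool => (List.ofFn w).count true = i),
    wordMap s d (List.ofFn w)

theorem wordMap_concat {A : Type*} (s d : A → A) (w : List Bool) (x : Bool) (b : A) :
    wordMap s d (w ++ [x]) b = wordMap s d w ((if x then s else d) b) := by
  induction w with
  | nil => rfl
  | cons y w ih => exact congrArg (if y then s else d) ih

theorem Pmap_apply {A : Type*} [AddCommMonoid A] (s d : A → A) (i n : ℕ) (b : A) :
    Pmap s d i n b = ∑ w : Fin n → Bool,
      if (List.ofFn w).count true = i then wordMap s d (List.ofFn w) b else 0 := by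
  rw [Pmap, Finset.sum_apply, Finset.sum_filter]

theorem Pmap_apply_succ {A : Type*} [AddCommMonoid A] (s d : A → A) (i n : ℕ) (b : A) :
    Pmap s d i (n + 1) b = (∑ w : Fin n → Bool,
      if (List.ofFn w).count true + 1 = i then wordMap s d (List.ofFn w) (s b) else 0)
        + Pmap s d i n (d b) := by
  rw [Pmap_apply, Pmap_apply, ← (Fin.snocEquiv fun _ => Bool).sum_comp, Fintype.sum_prod_type,
    Fintype.sum_bool]
  have h (x : Bool) (w : Fin n → Bool) :
      List.ofFn (Fin.snocEquiv (fun _ => Bool) (x, w)) = List.ofFn w ++ [x] := by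
    simp only [List.ofFn_succ', List.concat_eq_append, Fin.snocEquiv_apply, Fin.snoc_castSucc,
      Fin.snoc_last]
  simp [h, wordMap_concat, -List.ofFn_succ]

theorem Pmap_zero_succ {A : Type*} [AddCommMonoid A] (s d : A → A) (n : ℕ) (b : A) :
    Pmap s d 0 (n + 1) b = Pmap s d 0 n (d b) := by
  simp [Pmap_apply_succ]

theorem Pmap_succ_succ {A : Type*} [AddCommMonoid A] (s d : A → A) (i n : ℕ) (b : A) :
    Pmap s d (i + 1) (n + 1) b = Pmap s d i n (s b) + Pmap s d (i + 1) n (d b) := by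
  simp [Pmap_apply_succ, Pmap_apply s d i n]

theorem Pmap_eq_zero_of_lt {A : Type*} [AddCommMonoid A] (s d : A → A) {i n : ℕ} (h : n < i)
    (b : A) : Pmap s d i n b = 0 := by
  rw [Pmap_apply]
  refine Finset.sum_eq_zero fun w _ => if_neg fun hw => ?_
  have := List.count_le_length (a := true) (l := List.ofFn w)
  rw [hw, List.length_ofFn] at this
  omega

/-- The sum of `leftComp g d [i₁, …, i_p] a` over all `p`-tuples with `i₁ + ⋯ + i_p = k`. -/
def leftCompSum {A : Type*} [AddCommMonoid A] (g d : A → A) (p k : ℕ) (a : A) : A :=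
  ∑ i ∈ Finset.Nat.antidiagonalTuple p k, leftComp g d (List.ofFn i) a

theorem leftCompSum_zero_zero {A : Type*} [AddCommMonoid A] (g d : A → A) (a : A) :
    leftCompSum g d 0 0 a = a := by
  simp [leftCompSum, leftComp]

theorem leftCompSum_zero_succ {A : Type*} [AddCommMonoid A] (g d : A → A) (k : ℕ) (a : A) :
    leftCompSum g d 0 (k + 1) a = 0 := by
  simp [leftCompSum]

theorem leftCompSum_succ {A : Type*} [AddCommMonoid A] (g d : A →+ A) (p k : ℕ) (a : A) :
    leftCompSum g d (p + 1) k a = ∑ x ∈ Finset.HasAntidiagonal.antidiagonal k,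
      g ((d ∘ g)^[x.1] (leftCompSum g d p x.2 a)) := by
  have h : ∀ (m : ℕ) {ι : Type} (t : Finset ι) (f : ι → A),
      (d ∘ g)^[m] (∑ i ∈ t, f i) = ∑ i ∈ t, (d ∘ g)^[m] (f i) := by
    intro m ι t f
    induction m with
    | zero => rfl
    | succ m ih => simp only [Function.iterate_succ_apply', ih, Function.comp_apply, map_sum]
  simp only [leftCompSum, h, map_sum]
  rw [Finset.sum_sigma']
  symm
  refine Finset.sum_bij (fun x _ => (Fin.cons x.1.1 x.2 : Fin (p + 1) → ℕ)) ?_ ?_ ?_ ?_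
  · rintro ⟨⟨u, v⟩, t⟩ hx
    simp only [Finset.mem_sigma, Finset.HasAntidiagonal.mem_antidiagonal, Finset.Nat.mem_antidiagonalTuple] at hx
    simp [Finset.Nat.mem_antidiagonalTuple, Fin.sum_univ_succ, hx.1, hx.2]
  · rintro ⟨⟨u, v⟩, t⟩ hx ⟨⟨u', v'⟩, t'⟩ hx' he
    simp only [Finset.mem_sigma, Finset.HasAntidiagonal.mem_antidiagonal, Finset.Nat.mem_antidiagonalTuple] at hx hx'
    obtain ⟨rfl, rfl⟩ := Fin.cons_injective2 he
    obtain rfl : v = v' := hx.2.symm.trans hx'.2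
    rfl
  · intro t ht
    rw [Finset.Nat.mem_antidiagonalTuple, Fin.sum_univ_succ] at ht
    exact ⟨⟨(t 0, ∑ i : Fin p, t i.succ), Fin.tail t⟩,
      by simp [Finset.Nat.mem_antidiagonalTuple, ht, Fin.tail], Fin.cons_self_tail t⟩
  · rintro ⟨⟨u, v⟩, t⟩ _
    simp [List.ofFn_succ, leftComp]

theorem leftCompSum_succ_zero {A : Type*} [AddCommMonoid A] (g d : A →+ A) (p : ℕ) (a : A) :
    leftCompSum g d (p + 1) 0 a = g (leftCompSum g d p 0 a) := by
  simp [leftCompSum_succ]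

theorem leftCompSum_succ_succ {A : Type*} [AddCommMonoid A] (g d : A →+ A) (p k : ℕ) (a : A) :
    leftCompSum g d (p + 1) (k + 1) a
      = g (leftCompSum g d p (k + 1) a) + g (d (leftCompSum g d (p + 1) k a)) := by
  rw [leftCompSum_succ, leftCompSum_succ, Finset.Nat.sum_antidiagonal_succ]
  simp [Function.iterate_succ_apply']

theorem trace_mul_Pmap {A : Type*} [Ring A] [Algebra ℂ A]
    (σ : A ≃ₐ[ℂ] A) (δ : A →ₗ[ℂ] A) (τ : A →ₗ[ℂ] ℂ)
    (hδ : ∀ a b : A, δ (a * b) = δ a * b + σ a * δ b)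
    (hτ : ∀ a b : A, τ (a * b) = τ (σ b * a))
    (hτδ : ∀ a : A, τ (δ a) = 0)
    (n q k : ℕ) (hn : n = k + q) (a b : A) :
    τ (a * Pmap σ δ q n b) = (-1 : ℂ) ^ k * τ (b * leftCompSum σ.symm δ (q + 1) k a) := by
  have hτσ (x : A) : τ (σ x) = τ x := by simpa using (hτ 1 x).symm
  have hσ (x y : A) : τ (σ x * y) = τ (x * σ.symm y) := by
    rw [← hτσ (x * σ.symm y), map_mul σ, σ.apply_symm_apply]
  have hd (x y : A) : τ (δ x * y) = -τ (x * σ.symm (δ y)) := by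
    rw [← hσ, eq_neg_iff_add_eq_zero, ← map_add, ← hδ, hτδ]
  have hsz (p : ℕ) (a : A) : leftCompSum σ.symm δ (p + 1) 0 a
      = σ.symm (leftCompSum σ.symm δ p 0 a) :=
    leftCompSum_succ_zero (σ.symm : A →+ A) (δ : A →+ A) p a
  have hss (p k : ℕ) (a : A) : leftCompSum σ.symm δ (p + 1) (k + 1) a
      = σ.symm (leftCompSum σ.symm δ p (k + 1) a)
        + σ.symm (δ (leftCompSum σ.symm δ (p + 1) k a)) :=
    leftCompSum_succ_succ (σ.symm : A →+ A) (δ : A →+ A) p k a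
  induction n generalizing q k b with
  | zero =>
    obtain ⟨rfl, rfl⟩ : k = 0 ∧ q = 0 := by omega
    rw [hsz, leftCompSum_zero_zero, ← hσ, ← hτ]
    simp [Pmap_apply, wordMap]
  | succ n ih =>
    rcases q with _ | q <;> rcases k with _ | k
    · omega
    · rw [Pmap_zero_succ, ih 0 k (by omega), hss, leftCompSum_zero_succ, hd, map_zero σ.symm,
        zero_add (σ.symm _)]
      ring
    · rw [Pmap_succ_succ, Pmap_eq_zero_of_lt _ _ (by omega : n < q + 1), add_zero,
        ih q 0 (by omega), hsz (q + 1), hσ]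
    · rw [Pmap_succ_succ, mul_add, map_add, ih q (k + 1) (by omega), ih (q + 1) k (by omega),
        hss (q + 1), hσ, hd, mul_add, map_add]
      ring

/-- The coefficient identity `res (a ξⁿ b ξ⁻ᵖ) = res (b ξ⁻ᵖ a ξⁿ)` showing
that the noncommutative residue is a trace on the algebra of formal twisted
pseudodifferential symbols:
`τ (a ⬝ P_{p-1,n}(σ,δ)(b)) = (-1)^k ∑_{i₁+⋯+i_p = k} τ (b ⬝ σ⁻¹(δσ⁻¹)^{i₁} ⋯ σ⁻¹(δσ⁻¹)^{i_p}(a))`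
where `k = n - p + 1 ≥ 0`. -/
theorem residue_trace_coefficient_identity
    {A : Type*} [Ring A] [Algebra ℂ A]
    (σ : A ≃ₐ[ℂ] A) (δ : A →ₗ[ℂ] A) (τ : A →ₗ[ℂ] ℂ)
    (hδ : ∀ a b : A, δ (a * b) = δ a * b + σ a * δ b)
    (hτ : ∀ a b : A, τ (a * b) = τ (σ b * a))
    (hτδ : ∀ a : A, τ (δ a) = 0)
    (n p k : ℕ) (hp : 1 ≤ p) (hk : n + 1 = k + p) :
    ∀ a b : A,
      τ (a * Pmap (⇑σ) (⇑δ) (p - 1) n b)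
        = (-1 : ℂ) ^ k * ∑ i ∈ Finset.Nat.antidiagonalTuple p k,
            τ (b * leftComp (⇑σ.symm) (⇑δ) (List.ofFn i) a) := by
  intro a b
  obtain ⟨q, rfl⟩ := Nat.exists_eq_add_of_le' hp
  rw [Nat.add_sub_cancel]
  rw [← map_sum, ← Finset.mul_sum]
  exact trace_mul_Pmap σ δ τ hδ hτ hτδ n q k (by omega) a b
end

section
/- Let A be a unital associative ℂ-algebra, σ : A → A an algebra automorphism, and δ : A → A a σ-derivation with δ ∘ σ = σ ∘ δ. Let τ : A → ℂ be a trace (τ(ab) = τ(ba)) with τ ∘ σ = τ and τ ∘ δ = 0. Then for every integer n, every integer k ≥ 0, and all a, b ∈ A, τ(a · δ^{k+1}(σ^{n−k}(b))) = (−1)^{k+1} τ(b · δ^{k+1}(σ^{−n−1}(a))). (This is the key identity showing the noncommutative residue is a σ'⁻¹-twisted trace on the algebra of formal twisted pseudodifferential symbols, where σ' is the extension of σ acting on coefficients.) -/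
section TwistedDerivation

variable {R A : Type*} [CommRing R] [Ring A] [Algebra R A]

theorem AlgEquiv.apply_zpow_apply_of_commute {σ : A ≃ₐ[R] A} {f : A → A}
    (h : ∀ a, f (σ a) = σ (f a)) (z : ℤ) (a : A) : f ((σ ^ z) a) = (σ ^ z) (f a) := by
  revert a
  refine zpow_induction_left (g := σ) (P := fun g => ∀ a, f (g a) = g (f a))
    (fun a => rfl) (fun g hg a => ?_) (fun g hg a => ?_) z
  · rw [AlgEquiv.mul_apply, AlgEquiv.mul_apply, h, hg]
  · apply σ.injective
    rw [AlgEquiv.mul_apply, AlgEquiv.mul_apply, ← h]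
    simp [AlgEquiv.aut_inv, hg]

theorem AlgEquiv.apply_zpow_of_invariant {B : Type*} {σ : A ≃ₐ[R] A} {τ : A → B}
    (h : ∀ a, τ (σ a) = τ a) (z : ℤ) (a : A) : τ ((σ ^ z) a) = τ a := by
  revert a
  refine zpow_induction_left (g := σ) (P := fun g => ∀ a, τ (g a) = τ a)
    (fun a => rfl) (fun g hg a => ?_) (fun g hg a => ?_) z
  · rw [AlgEquiv.mul_apply, h, hg]
  · rw [AlgEquiv.mul_apply, ← h]
    simp [AlgEquiv.aut_inv, hg]

/-- Iterated integration by parts for a twisted derivation. -/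
theorem apply_mul_iterate_twistedDerivation
    {σ : A ≃ₐ[R] A} {δ : A → A} {τ : A →ₗ[R] R}
    (hδ : ∀ a b, δ (a * b) = δ a * b + σ a * δ b)
    (hcomm : ∀ a, δ (σ a) = σ (δ a)) (hτδ : ∀ a, τ (δ a) = 0) (m : ℕ) (a c : A) :
    τ (a * δ^[m] c) = (-1) ^ m * τ (δ^[m] ((σ ^ (-(m : ℤ))) a) * c) := by
  induction m generalizing a with
  | zero => simp
  | succ m ih =>
    have parts : τ (a * δ (δ^[m] c)) = -τ (δ ((σ ^ (-1 : ℤ)) a) * δ^[m] c) := by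
      have h := hτδ ((σ ^ (-1 : ℤ)) a * δ^[m] c)
      have hσ : σ ((σ ^ (-1 : ℤ)) a) = a := by simp [AlgEquiv.aut_inv]
      rw [hδ, map_add, hσ] at h
      exact eq_neg_of_add_eq_zero_right h
    have exponent : (σ ^ (-(m : ℤ))) ((σ ^ (-1 : ℤ)) a) = (σ ^ (-((m + 1 : ℕ) : ℤ))) a := by
      rw [← AlgEquiv.mul_apply, ← zpow_add]
      congr 2
      push_cast
      ring
    rw [Function.iterate_succ_apply', parts, ih,
      ← AlgEquiv.apply_zpow_apply_of_commute hcomm, ← Function.iterate_succ_apply, exponent,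
      pow_succ]
    ring

end TwistedDerivation


/-- Let `δ` be a `σ`-derivation commuting with `σ` and `τ` an ordinary
trace with `τ ∘ σ = τ` and `τ ∘ δ = 0`.  Then for every `n : ℤ` and `k : ℕ`,
`τ (a ⬝ δ^{k+1}(σ^{n-k}(b))) = (-1)^{k+1} τ (b ⬝ δ^{k+1}(σ^{-n-1}(a)))`.
(Key identity showing the noncommutative residue is a `σ'⁻¹`-twisted trace on the
algebra of formal twisted pseudodifferential symbols.) -/
theorem residue_twisted_trace_identity
    {A : Type*} [Ring A] [Algebra ℂ A]
    (σ : A ≃ₐ[ℂ] A) (δ : A →ₗ[ℂ] A)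
    (hδ : ∀ a b : A, δ (a * b) = δ a * b + σ a * δ b)
    (hcomm : ∀ a : A, δ (σ a) = σ (δ a))
    (τ : A →ₗ[ℂ] ℂ)
    (hτtr : ∀ a b : A, τ (a * b) = τ (b * a))
    (hτσ : ∀ a : A, τ (σ a) = τ a)
    (hτδ : ∀ a : A, τ (δ a) = 0) :
    ∀ (n : ℤ) (k : ℕ) (a b : A),
      τ (a * (⇑δ)^[k + 1] ((σ ^ (n - (k : ℤ))) b))
        = (-1 : ℂ) ^ (k + 1) * τ (b * (⇑δ)^[k + 1] ((σ ^ (-n - 1)) a)) := by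
  intro n k a b
  have hiter : ∀ x, (⇑δ)^[k + 1] (σ x) = σ ((⇑δ)^[k + 1] x) :=
    Function.Commute.iterate_left (f := ⇑δ) (g := ⇑σ) hcomm (k + 1)
  rw [apply_mul_iterate_twistedDerivation hδ hcomm hτδ,
    ← AlgEquiv.apply_zpow_of_invariant hτσ (-(n - (k : ℤ))), map_mul,
    ← AlgEquiv.apply_zpow_apply_of_commute hiter, ← AlgEquiv.mul_apply, ← AlgEquiv.mul_apply,
    ← zpow_add, ← zpow_add, neg_add_cancel, zpow_zero, AlgEquiv.one_apply, hτtr]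
  congr 6
  push_cast
  ring
end

section
/- Let A be a unital associative ℂ-algebra, σ : A → A an algebra automorphism, δ : A → A a σ-derivation, and τ : A → ℂ a σ²-trace with τ ∘ σ = τ and τ ∘ δ = 0. Then for every non-negative integer i and all a, b ∈ A, τ(b · (σ⁻¹ ∘ (δ∘σ⁻¹)^i)(a)) = (−1)^i τ(σ(a) · δ^i(b)). -/
/-- part of Lemma 4.1. For a `σ²`-trace `τ` with `τ ∘ σ = τ` and
`τ ∘ δ = 0`, and a `σ`-derivation `δ`,
`τ (b ⬝ (σ⁻¹ ∘ (δ∘σ⁻¹)^i)(a)) = (-1)^i τ (σ(a) ⬝ δ^i(b))`. -/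
theorem sigma_sq_trace_iterate_identity
    {A : Type*} [Ring A] [Algebra ℂ A]
    (σ : A ≃ₐ[ℂ] A) (δ : A →ₗ[ℂ] A) (τ : A →ₗ[ℂ] ℂ)
    (hδ : ∀ a b : A, δ (a * b) = δ a * b + σ a * δ b)
    (hτ : ∀ a b : A, τ (a * b) = τ (σ (σ b) * a))
    (hτσ : ∀ a : A, τ (σ a) = τ a)
    (hτδ : ∀ a : A, τ (δ a) = 0) :
    ∀ (i : ℕ) (a b : A),
      τ (b * σ.symm ((⇑δ ∘ ⇑σ.symm)^[i] a)) = (-1 : ℂ) ^ i * τ (σ a * (⇑δ)^[i] b) := by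
  have hswap : ∀ c d : A, τ (σ (δ c) * d) = -τ (σ (σ c) * δ d) := by
    intro c d
    have h₁ : τ (σ (δ c) * d) = τ (σ d * δ c) := by
      rw [← hτσ (σ (δ c) * d), map_mul, ← hτ]
    have h₂ : τ (δ d * c) + τ (σ d * δ c) = 0 := by
      rw [← map_add, ← hδ, hτδ]
    rw [h₁, ← hτ]
    exact eq_neg_of_add_eq_zero_right h₂
  intro i
  induction i with
  | zero =>
    intro a b
    simp [hτ b]
  | succ n ih =>
    intro a b
    rw [Function.iterate_succ_apply, ih, Function.comp_apply, hswap,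
      Function.iterate_succ_apply', σ.apply_symm_apply, pow_succ]
    ring
end

section
/- Let A be a unital associative ℂ-algebra, σ : A → A an algebra automorphism, δ : A → A a σ-derivation, and τ : A → ℂ a σ²-trace with τ ∘ σ = τ and τ ∘ δ = 0. Then for every non-negative integer i and all a, b ∈ A, τ((δ∘σ⁻¹)^i(a) · b) = (−1)^i τ(a · δ^i(b)). -/
/-- part of Lemma 4.1. For a `σ²`-trace `τ` with `τ ∘ σ = τ` and
`τ ∘ δ = 0`, and a `σ`-derivation `δ`,
`τ ((δ∘σ⁻¹)^i(a) ⬝ b) = (-1)^i τ (a ⬝ δ^i(b))`. -/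
theorem sigma_sq_trace_iterate_identity_left
    {A : Type*} [Ring A] [Algebra ℂ A]
    (σ : A ≃ₐ[ℂ] A) (δ : A →ₗ[ℂ] A) (τ : A →ₗ[ℂ] ℂ)
    (hδ : ∀ a b : A, δ (a * b) = δ a * b + σ a * δ b)
    (hτ : ∀ a b : A, τ (a * b) = τ (σ (σ b) * a))
    (hτσ : ∀ a : A, τ (σ a) = τ a)
    (hτδ : ∀ a : A, τ (δ a) = 0) :
    ∀ (i : ℕ) (a b : A),
      τ ((⇑δ ∘ ⇑σ.symm)^[i] a * b) = (-1 : ℂ) ^ i * τ (a * (⇑δ)^[i] b) := by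
  intro i
  induction i with
  | zero => simp
  | succ i ih =>
    intro a b
    have h := hτδ (σ.symm a * (⇑δ)^[i] b)
    rw [hδ, map_add, AlgEquiv.apply_symm_apply] at h
    rw [Function.iterate_succ_apply, ih, Function.comp_apply, Function.iterate_succ_apply',
      eq_neg_of_add_eq_zero_left h]
    ring
end

section
/- Let A be a unital associative ℂ-algebra, σ : A → A an algebra automorphism, δ : A → A a σ-derivation, and τ : A → ℂ a σ²-trace with τ ∘ σ = τ and τ ∘ δ = 0. Then for every non-negative integer i and all a, b ∈ A, τ(a · δ^i(b)) = (−1)^i τ(σ²(b) · (δ∘σ⁻¹)^i(a)). -/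
/-- Integration by parts for a linear functional that vanishes on the range of a twisted
derivation. -/
theorem map_mul_iterate_twisted_derivation
    {R A M : Type*} [CommRing R] [Ring A] [Algebra R A] [AddCommGroup M] [Module R M]
    (σ : A ≃ₐ[R] A) (δ : A →ₗ[R] A) (τ : A →ₗ[R] M)
    (hδ : ∀ a b : A, δ (a * b) = δ a * b + σ a * δ b)
    (hτδ : ∀ a : A, τ (δ a) = 0) (i : ℕ) (a b : A) :
    τ (a * (⇑δ)^[i] b) = (-1 : R) ^ i • τ ((⇑δ ∘ ⇑σ.symm)^[i] a * b) := by
  induction i generalizing a with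
  | zero => simp
  | succ i ih =>
    have h := hτδ (σ.symm a * (⇑δ)^[i] b)
    rw [hδ, map_add, σ.apply_symm_apply, add_comm] at h
    rw [Function.iterate_succ_apply', eq_neg_of_add_eq_zero_left h, ih,
      Function.iterate_succ_apply, Function.comp_apply, pow_succ', neg_one_mul, neg_smul]

/-- part of Lemma 4.1. For a `σ²`-trace `τ` with `τ ∘ σ = τ` and
`τ ∘ δ = 0`, and a `σ`-derivation `δ`,
`τ (a ⬝ δ^i(b)) = (-1)^i τ (σ²(b) ⬝ (δ∘σ⁻¹)^i(a))`. -/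
theorem sigma_sq_trace_iterate_identity_right
    {A : Type*} [Ring A] [Algebra ℂ A]
    (σ : A ≃ₐ[ℂ] A) (δ : A →ₗ[ℂ] A) (τ : A →ₗ[ℂ] ℂ)
    (hδ : ∀ a b : A, δ (a * b) = δ a * b + σ a * δ b)
    (hτ : ∀ a b : A, τ (a * b) = τ (σ (σ b) * a))
    (hτσ : ∀ a : A, τ (σ a) = τ a)
    (hτδ : ∀ a : A, τ (δ a) = 0) :
    ∀ (i : ℕ) (a b : A),
      τ (a * (⇑δ)^[i] b) = (-1 : ℂ) ^ i * τ (σ (σ b) * (⇑δ ∘ ⇑σ.symm)^[i] a) := by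
  intro i a b
  rw [map_mul_iterate_twisted_derivation σ δ τ hδ hτδ, hτ, smul_eq_mul]
end

section
/- Let A be a unital associative ℂ-algebra, σ : A → A an algebra automorphism, δ₁, δ₂ : A → A two σ-derivations, and τ : A → ℂ a σ²-trace with τ ∘ σ = τ, τ ∘ δ₁ = 0 and τ ∘ δ₂ = 0. Then for all a, b ∈ A and all tuples of non-negative integers i = (i₁,…,i_q) and j = (j₁,…,j_p): τ(b · (σ⁻¹∘(δ₁∘σ⁻¹)^{j₁}) ∘ ⋯ ∘ (σ⁻¹∘(δ₁∘σ⁻¹)^{j_p}) ∘ (σ⁻¹∘(δ₂∘σ⁻¹)^{i₁}) ∘ ⋯ ∘ (σ⁻¹∘(δ₂∘σ⁻¹)^{i_q})(a)) = (−1)^{|i|+|j|} τ(a · (δ₂^{i_q} ∘ σ ∘ δ₂^{i_{q−1}} ∘ ⋯ ∘ σ ∘ δ₂^{i₁}) ∘ (δ₁^{j_p} ∘ σ ∘ δ₁^{j_{p−1}} ∘ ⋯ ∘ σ ∘ δ₁^{j₁})(b)), where |i| = i₁+⋯+i_q and |j| = j₁+⋯+j_p. -/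
open Function

section TraceRadical

variable {A : Type*} [Ring A] [Algebra ℂ A]

/-- Two elements are equivalent when they pair equally under `τ` with every left factor. -/
def TraceEq (τ : A →ₗ[ℂ] ℂ) (x y : A) : Prop := ∀ a : A, τ (a * x) = τ (a * y)

/-- Maps that respect `TraceEq τ` and commute with `σ` up to `TraceEq τ`. -/
def TraceCompat (σ : A ≃ₐ[ℂ] A) (τ : A →ₗ[ℂ] ℂ) (f : A → A) : Prop :=
  (∀ x y, TraceEq τ x y → TraceEq τ (f x) (f y)) ∧ ∀ x, TraceEq τ (f (σ x)) (σ (f x))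

variable {σ : A ≃ₐ[ℂ] A} {δ : A →ₗ[ℂ] A} {τ : A →ₗ[ℂ] ℂ}

theorem TraceEq.trans {x y z : A} (h : TraceEq τ x y) (h' : TraceEq τ y z) : TraceEq τ x z :=
  fun a => (h a).trans (h' a)

theorem TraceCompat.id : TraceCompat σ τ id := ⟨fun _ _ h => h, fun _ _ => rfl⟩

theorem TraceCompat.comp {f g : A → A} (hf : TraceCompat σ τ f) (hg : TraceCompat σ τ g) :
    TraceCompat σ τ (f ∘ g) :=
  ⟨fun _ _ h => hf.1 _ _ (hg.1 _ _ h), fun x => (hf.1 _ _ (hg.2 x)).trans (hf.2 (g x))⟩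

theorem TraceCompat.iterate {f : A → A} (hf : TraceCompat σ τ f) (n : ℕ) :
    TraceCompat σ τ f^[n] := by
  induction n with
  | zero => exact TraceCompat.id
  | succ n ih => exact ih.comp hf

theorem trace_mul_symm_apply (hτσ : ∀ a : A, τ (σ a) = τ a) (a x : A) :
    τ (a * σ.symm x) = τ (σ a * x) := by
  rw [← hτσ (a * σ.symm x), map_mul σ, σ.apply_symm_apply]

theorem trace_mul_apply (hτσ : ∀ a : A, τ (σ a) = τ a) (a x : A) :
    τ (a * σ x) = τ (σ.symm a * x) := by
  rw [← hτσ (σ.symm a * x), map_mul σ, σ.apply_symm_apply]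

/-- Integration by parts for a `σ`-derivation annihilated by `τ`. -/
theorem trace_apply_mul_derivation (hδ : ∀ a b : A, δ (a * b) = δ a * b + σ a * δ b)
    (hτδ : ∀ a : A, τ (δ a) = 0) (a x : A) : τ (σ a * δ x) = -τ (δ a * x) := by
  have h := hτδ (a * x)
  rw [hδ, map_add] at h
  exact eq_neg_of_add_eq_zero_right h

theorem traceCompat_automorphism (hτσ : ∀ a : A, τ (σ a) = τ a) : TraceCompat σ τ σ := by
  refine ⟨fun x y h a => ?_, fun x a => rfl⟩
  rw [trace_mul_apply hτσ, trace_mul_apply hτσ, h]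

theorem traceCompat_derivation (hδ : ∀ a b : A, δ (a * b) = δ a * b + σ a * δ b)
    (hτ : ∀ a b : A, τ (a * b) = τ (σ (σ b) * a))
    (hτσ : ∀ a : A, τ (σ a) = τ a) (hτδ : ∀ a : A, τ (δ a) = 0) : TraceCompat σ τ δ := by
  refine ⟨fun x y h a => ?_, fun x a => ?_⟩
  · obtain ⟨a, rfl⟩ := σ.surjective a
    rw [trace_apply_mul_derivation hδ hτδ, trace_apply_mul_derivation hδ hτδ, h]
  · obtain ⟨a, rfl⟩ := σ.surjective a
    obtain ⟨a, rfl⟩ := σ.surjective a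
    rw [trace_mul_apply hτσ, σ.symm_apply_apply, trace_apply_mul_derivation hδ hτδ a x,
      hτ (δ a) x, trace_apply_mul_derivation hδ hτδ (σ x) a, neg_neg, hτ (δ (σ x)) a]

theorem TraceCompat.rightCompTail {s d : A → A} (hs : TraceCompat σ τ s)
    (hd : TraceCompat σ τ d) (l : List ℕ) : TraceCompat σ τ (rightCompTail s d l) := by
  induction l with
  | nil => exact TraceCompat.id
  | cons i t ih => exact ih.comp ((hd.iterate i).comp hs)

theorem TraceCompat.rightComp {s d : A → A} (hs : TraceCompat σ τ s)
    (hd : TraceCompat σ τ d) (l : List ℕ) : TraceCompat σ τ (rightComp s d l) := by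
  cases l with
  | nil => exact TraceCompat.id
  | cons i t => exact (hs.rightCompTail hd t).comp (hd.iterate i)

theorem trace_mul_iterate (hδ : ∀ a b : A, δ (a * b) = δ a * b + σ a * δ b)
    (hτσ : ∀ a : A, τ (σ a) = τ a) (hτδ : ∀ a : A, τ (δ a) = 0) (n : ℕ) (b x : A) :
    τ (b * (σ.symm ∘ (δ ∘ σ.symm)^[n]) x) = (-1) ^ n * τ (σ (δ^[n] b) * x) := by
  rw [comp_apply, trace_mul_symm_apply hτσ]
  induction n generalizing b with
  | zero => simp
  | succ n ih =>
    rw [iterate_succ_apply', comp_apply, trace_apply_mul_derivation hδ hτδ,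
      trace_mul_symm_apply hτσ, ih, iterate_succ_apply, pow_succ]
    ring

theorem trace_mul_leftComp_tail (hδ : ∀ a b : A, δ (a * b) = δ a * b + σ a * δ b)
    (hτσ : ∀ a : A, τ (σ a) = τ a) (hτδ : ∀ a : A, τ (δ a) = 0) (l : List ℕ) (b x : A) :
    τ (σ b * leftComp σ.symm δ l x) = (-1) ^ l.sum * τ (σ (rightCompTail σ δ l b) * x) := by
  induction l generalizing b with
  | nil => simp [leftComp, rightCompTail]
  | cons i t ih =>
    rw [leftComp, comp_apply, trace_mul_iterate hδ hτσ hτδ, ih, List.sum_cons, pow_add, mul_assoc]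
    rfl

theorem trace_mul_leftComp (hδ : ∀ a b : A, δ (a * b) = δ a * b + σ a * δ b)
    (hτσ : ∀ a : A, τ (σ a) = τ a) (hτδ : ∀ a : A, τ (δ a) = 0) {l : List ℕ} (hl : l ≠ [])
    (b x : A) :
    τ (b * leftComp σ.symm δ l x) = (-1) ^ l.sum * τ (σ (rightComp σ δ l b) * x) := by
  cases l with
  | nil => exact absurd rfl hl
  | cons i t =>
    rw [leftComp, comp_apply, trace_mul_iterate hδ hτσ hτδ, trace_mul_leftComp_tail hδ hτσ hτδ,
      List.sum_cons, pow_add, mul_assoc]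
    rfl

end TraceRadical

/-- Lemma 4.1, first identity. For two `σ`-derivations `δ₁, δ₂` and a
`σ²`-trace `τ` with `τ ∘ σ = τ`, `τ ∘ δ₁ = 0`, `τ ∘ δ₂ = 0`, and nonempty tuples
`j = (j₁,…,j_p)`, `i = (i₁,…,i_q)`:
`τ (b ⬝ σ⁻¹(δ₁σ⁻¹)^{j₁} ⋯ σ⁻¹(δ₁σ⁻¹)^{j_p} σ⁻¹(δ₂σ⁻¹)^{i₁} ⋯ σ⁻¹(δ₂σ⁻¹)^{i_q}(a))
 = (-1)^{|i|+|j|} τ (a ⬝ δ₂^{i_q} σ ⋯ σ δ₂^{i₁} δ₁^{j_p} σ ⋯ σ δ₁^{j₁}(b))`. -/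
theorem multidim_trace_lemma_first
    {A : Type*} [Ring A] [Algebra ℂ A]
    (σ : A ≃ₐ[ℂ] A) (δ₁ δ₂ : A →ₗ[ℂ] A) (τ : A →ₗ[ℂ] ℂ)
    (hδ₁ : ∀ a b : A, δ₁ (a * b) = δ₁ a * b + σ a * δ₁ b)
    (hδ₂ : ∀ a b : A, δ₂ (a * b) = δ₂ a * b + σ a * δ₂ b)
    (hτ : ∀ a b : A, τ (a * b) = τ (σ (σ b) * a))
    (hτσ : ∀ a : A, τ (σ a) = τ a)
    (hτδ₁ : ∀ a : A, τ (δ₁ a) = 0)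
    (hτδ₂ : ∀ a : A, τ (δ₂ a) = 0) :
    ∀ (i j : List ℕ), i ≠ [] → j ≠ [] → ∀ a b : A,
      τ (b * leftComp (⇑σ.symm) (⇑δ₁) j (leftComp (⇑σ.symm) (⇑δ₂) i a))
        = (-1 : ℂ) ^ (i.sum + j.sum)
            * τ (a * rightComp (⇑σ) (⇑δ₂) i (rightComp (⇑σ) (⇑δ₁) j b)) := by
  intro i j hi hj a b
  have hσ := traceCompat_automorphism hτσ
  have hR := hσ.rightComp (traceCompat_derivation hδ₂ hτ hτσ hτδ₂) i
  rw [trace_mul_leftComp hδ₁ hτσ hτδ₁ hj, trace_mul_leftComp hδ₂ hτσ hτδ₂ hi, ← mul_assoc,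
    ← pow_add, add_comm j.sum, hτ a, hτ _ a, hτ _ a]
  congr 1
  exact hσ.1 _ _ (hR.2 (rightComp σ δ₁ j b)) (σ (σ a))
end

section
/- Let A be a unital associative ℂ-algebra, σ : A → A an algebra automorphism, δ₁, δ₂ : A → A two σ-derivations, and τ : A → ℂ a σ²-trace with τ ∘ σ = τ, τ ∘ δ₁ = 0 and τ ∘ δ₂ = 0. Then for all a, b ∈ A and all tuples of non-negative integers i = (i₁,…,i_q) and j = (j₁,…,j_p): τ(a · (δ₁^{j₁} ∘ σ ∘ δ₁^{j₂} ∘ ⋯ ∘ σ ∘ δ₁^{j_p}) ∘ (σ⁻¹∘(δ₂∘σ⁻¹)^{i₁}) ∘ ⋯ ∘ (σ⁻¹∘(δ₂∘σ⁻¹)^{i_q})(b)) = (−1)^{|i|+|j|} τ(b · (δ₂^{i_q} ∘ σ ∘ δ₂^{i_{q−1}} ∘ ⋯ ∘ σ ∘ δ₂^{i₁}) ∘ (σ⁻¹∘(δ₁∘σ⁻¹)^{j_p}) ∘ ⋯ ∘ (σ⁻¹∘(δ₁∘σ⁻¹)^{j₁})(a)), where |i| = i₁+⋯+i_q and |j|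 = j₁+⋯+j_p. -/
open Function

section TraceAdjoint

variable {A : Type*} [Ring A] [Algebra ℂ A] (σ : A ≃ₐ[ℂ] A) (δ : A →ₗ[ℂ] A) (τ : A →ₗ[ℂ] ℂ)

/-- The adjoint of `σ` for the pairing `(a, b) ↦ τ (a * b)` is `σ⁻¹`. -/
theorem trace_mul_apply_automorphism (hτσ : ∀ a : A, τ (σ a) = τ a) (a b : A) :
    τ (a * σ b) = τ (σ.symm a * b) := by
  rw [← hτσ (σ.symm a * b), map_mul σ, σ.apply_symm_apply]

/-- The adjoint of `δ` for the pairing `(a, b) ↦ τ (a * b)` is `-δ ∘ σ⁻¹`. -/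
theorem trace_mul_apply_derivation
    (hδ : ∀ a b : A, δ (a * b) = δ a * b + σ a * δ b) (hτδ : ∀ a : A, τ (δ a) = 0) (a b : A) :
    τ (a * δ b) = -τ (δ (σ.symm a) * b) := by
  have h := hτδ (σ.symm a * b)
  rw [hδ, map_add, σ.apply_symm_apply] at h
  exact eq_neg_of_add_eq_zero_right h

theorem trace_mul_iterate_derivation
    (hδ : ∀ a b : A, δ (a * b) = δ a * b + σ a * δ b) (hτδ : ∀ a : A, τ (δ a) = 0)
    (n : ℕ) (a b : A) :
    τ (a * δ^[n] b) = (-1 : ℂ) ^ n * τ ((⇑δ ∘ ⇑σ.symm)^[n] a * b) := by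
  induction n generalizing a with
  | zero => simp
  | succ n ih =>
    rw [iterate_succ_apply', trace_mul_apply_derivation σ δ τ hδ hτδ, ih, iterate_succ_apply,
      pow_succ, comp_apply]
    ring

theorem trace_mul_rightCompTail
    (hδ : ∀ a b : A, δ (a * b) = δ a * b + σ a * δ b)
    (hτσ : ∀ a : A, τ (σ a) = τ a) (hτδ : ∀ a : A, τ (δ a) = 0) (l : List ℕ) (a b : A) :
    τ (a * rightCompTail σ δ l b) = (-1 : ℂ) ^ l.sum * τ (leftComp σ.symm δ l a * b) := by
  induction l generalizing b with
  | nil => simp [rightCompTail, leftComp]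
  | cons n l ih =>
    simp only [rightCompTail, leftComp, comp_apply, List.sum_cons]
    rw [ih, trace_mul_iterate_derivation σ δ τ hδ hτδ, trace_mul_apply_automorphism σ τ hτσ,
      pow_add]
    ring

theorem trace_mul_rightComp
    (hδ : ∀ a b : A, δ (a * b) = δ a * b + σ a * δ b)
    (hτσ : ∀ a : A, τ (σ a) = τ a) (hτδ : ∀ a : A, τ (δ a) = 0)
    {l : List ℕ} (hl : l ≠ []) (a b : A) :
    τ (a * rightComp σ δ l b) = (-1 : ℂ) ^ l.sum * τ (σ (leftComp σ.symm δ l a) * b) := by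
  cases l with
  | nil => exact absurd rfl hl
  | cons n l =>
    simp only [rightComp, leftComp, comp_apply, List.sum_cons, AlgEquiv.apply_symm_apply]
    rw [trace_mul_rightCompTail σ δ τ hδ hτσ hτδ, trace_mul_iterate_derivation σ δ τ hδ hτδ,
      pow_add]
    ring

end TraceAdjoint

/-- Lemma 4.1, second identity. For two `σ`-derivations `δ₁, δ₂` and a
`σ²`-trace `τ` with `τ ∘ σ = τ`, `τ ∘ δ₁ = 0`, `τ ∘ δ₂ = 0`, and nonempty tuples
`j = (j₁,…,j_p)`, `i = (i₁,…,i_q)`: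
`τ (a ⬝ δ₁^{j₁} σ δ₁^{j₂} ⋯ σ δ₁^{j_p} σ⁻¹(δ₂σ⁻¹)^{i₁} ⋯ σ⁻¹(δ₂σ⁻¹)^{i_q}(b))
 = (-1)^{|i|+|j|} τ (b ⬝ δ₂^{i_q} σ ⋯ σ δ₂^{i₁} σ⁻¹(δ₁σ⁻¹)^{j_p} ⋯ σ⁻¹(δ₁σ⁻¹)^{j₁}(a))`.
Here `δ₁^{j₁} σ δ₁^{j₂} ⋯ σ δ₁^{j_p}` is `rightComp σ δ₁` of the reversed list `j`. -/
theorem multidim_trace_lemma_second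
    {A : Type*} [Ring A] [Algebra ℂ A]
    (σ : A ≃ₐ[ℂ] A) (δ₁ δ₂ : A →ₗ[ℂ] A) (τ : A →ₗ[ℂ] ℂ)
    (hδ₁ : ∀ a b : A, δ₁ (a * b) = δ₁ a * b + σ a * δ₁ b)
    (hδ₂ : ∀ a b : A, δ₂ (a * b) = δ₂ a * b + σ a * δ₂ b)
    (hτ : ∀ a b : A, τ (a * b) = τ (σ (σ b) * a))
    (hτσ : ∀ a : A, τ (σ a) = τ a)
    (hτδ₁ : ∀ a : A, τ (δ₁ a) = 0)
    (hτδ₂ : ∀ a : A, τ (δ₂ a) = 0) :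
    ∀ (i j : List ℕ), i ≠ [] → j ≠ [] → ∀ a b : A,
      τ (a * rightComp (⇑σ) (⇑δ₁) j.reverse (leftComp (⇑σ.symm) (⇑δ₂) i b))
        = (-1 : ℂ) ^ (i.sum + j.sum)
            * τ (b * rightComp (⇑σ) (⇑δ₂) i (leftComp (⇑σ.symm) (⇑δ₁) j.reverse a)) := by
  intro i j hi hj a b
  rw [trace_mul_rightComp σ δ₁ τ hδ₁ hτσ hτδ₁ (List.reverse_ne_nil_iff.mpr hj),
    trace_mul_rightComp σ δ₂ τ hδ₂ hτσ hτδ₂ hi, List.sum_reverse, hτ (σ (leftComp _ _ i b)),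
    ← map_mul σ, hτσ, pow_add, mul_comm ((-1 : ℂ) ^ i.sum), mul_assoc, ← mul_assoc (_ ^ i.sum),
    ← mul_pow]
  simp
end

section
/- Let A be a unital associative ℂ-algebra, σ : A → A an algebra automorphism, δ : A → A a σ-derivation, and τ : A → ℂ a σ²-trace with τ ∘ σ = τ and τ ∘ δ = 0. Then for all a, b ∈ A, τ(a · σ(δ(b))) = τ(a · δ(σ(b))) and τ(a · σ⁻¹(δ(b))) = τ(a · δ(σ⁻¹(b))). -/
/-- For a `σ`-derivation `δ` and a `σ²`-trace `τ` with `τ ∘ σ = τ` and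
`τ ∘ δ = 0`, one has `τ (a ⬝ σ(δ(b))) = τ (a ⬝ δ(σ(b)))` and
`τ (a ⬝ σ⁻¹(δ(b))) = τ (a ⬝ δ(σ⁻¹(b)))`. -/
theorem sigma_delta_swap_under_trace
    {A : Type*} [Ring A] [Algebra ℂ A]
    (σ : A ≃ₐ[ℂ] A) (δ : A →ₗ[ℂ] A) (τ : A →ₗ[ℂ] ℂ)
    (hδ : ∀ a b : A, δ (a * b) = δ a * b + σ a * δ b)
    (hτ : ∀ a b : A, τ (a * b) = τ (σ (σ b) * a))
    (hτσ : ∀ a : A, τ (σ a) = τ a)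
    (hτδ : ∀ a : A, τ (δ a) = 0) :
    ∀ a b : A,
      τ (a * σ (δ b)) = τ (a * δ (σ b)) ∧
      τ (a * σ.symm (δ b)) = τ (a * δ (σ.symm b)) := by
  have parts (x y : A) : τ (σ x * δ y) = -τ (δ x * y) := by
    have h := hτδ (x * y)
    rw [hδ, map_add] at h
    exact eq_neg_of_add_eq_zero_right h
  have swap (a b : A) : τ (a * σ (δ b)) = τ (a * δ (σ b)) := by
    obtain ⟨u, rfl⟩ := σ.surjective a
    obtain ⟨v, rfl⟩ := σ.surjective u
    calc τ (σ (σ v) * σ (δ b)) = τ (σ v * δ b) := by rw [← map_mul, hτσ]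
      _ = -τ (σ (σ b) * δ v) := by rw [parts, hτ]
      _ = τ (δ (σ b) * v) := by rw [parts, neg_neg]
      _ = τ (σ (σ v) * δ (σ b)) := hτ _ _
  intro a b
  refine ⟨swap a b, ?_⟩
  calc τ (a * σ.symm (δ b)) = τ (σ a * δ b) := by
        rw [← hτσ, map_mul, σ.apply_symm_apply]
    _ = τ (σ a * σ (δ (σ.symm b))) := by rw [swap, σ.apply_symm_apply]
    _ = τ (a * δ (σ.symm b)) := by rw [← map_mul, hτσ]
end

section
/- Let A be a unital associative ℂ-algebra, σ : A → A an algebra automorphism, δ₁, δ₂ : A → A two σ-derivations with δ₁ ∘ δ₂ = δ₂ ∘ δ₁, and τ : A → ℂ a σ²-trace with τ ∘ σ = τ, τ ∘ δ₁ = 0 and τ ∘ δ₂ = 0. Then for all a, b ∈ A, every r-tuple n = (n₁,…,n_r) of integers, and all r-tuples i = (i₁,…,i_r), j = (j₁,…,j_r) of non-negative integers, the value τ(a · (σ^{n₁} ∘ δ₁^{i₁} ∘ δ₂^{j₁}) ∘ ⋯ ∘ (σ^{n_r} ∘ δ₁^{i_r} ∘ δ₂^{j_r})(b)) depends only on the sums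 n₁+⋯+n_r, i₁+⋯+i_r and j₁+⋯+j_r; that is, it equals τ(a · (σ^{n₁+⋯+n_r} ∘ δ₁^{i₁+⋯+i_r} ∘ δ₂^{j₁+⋯+j_r})(b)). -/
open Function

/-- The composite `(σ^{n₁} ∘ d₁^[i₁] ∘ d₂^[j₁]) ∘ ⋯ ∘ (σ^{n_r} ∘ d₁^[i_r] ∘ d₂^[j_r])`
associated to a list of triples `[(n₁,i₁,j₁), …, (n_r,i_r,j_r)]`, where `σ^{n}` denotes
the `n`-th (integer) power of the automorphism `σ`. -/
def mixComp {A : Type*} [Ring A] [Algebra ℂ A] (σ : A ≃ₐ[ℂ] A) (d₁ d₂ : A → A) :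
    List (ℤ × ℕ × ℕ) → (A → A)
  | [] => id
  | (n, i, j) :: t => (⇑(σ ^ n) ∘ d₁^[i] ∘ d₂^[j]) ∘ mixComp σ d₁ d₂ t

/-- Two elements are equivalent when they pair equally with every element under `τ`. -/
def TraceEquiv {A : Type*} [Ring A] [Algebra ℂ A] (τ : A →ₗ[ℂ] ℂ) (b c : A) : Prop :=
  ∀ a : A, τ (a * b) = τ (a * c)

namespace TraceEquiv

variable {A : Type*} [Ring A] [Algebra ℂ A] {σ : A ≃ₐ[ℂ] A} {δ : A →ₗ[ℂ] A} {τ : A →ₗ[ℂ] ℂ}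

theorem rfl {b : A} : TraceEquiv τ b b := fun _ => Eq.refl _

theorem symm {b c : A} (h : TraceEquiv τ b c) : TraceEquiv τ c b := fun a => (h a).symm

theorem trans {b c d : A} (h : TraceEquiv τ b c) (h' : TraceEquiv τ c d) :
    TraceEquiv τ b d := fun a => (h a).trans (h' a)

theorem map_algEquiv (hτσ : ∀ a : A, τ (σ a) = τ a) {b c : A} (h : TraceEquiv τ b c) :
    TraceEquiv τ (σ b) (σ c) := fun a => by
  obtain ⟨a, rfl⟩ := σ.surjective a
  rw [← map_mul, ← map_mul, hτσ, hτσ, h]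

theorem trace_zpow (hτσ : ∀ a : A, τ (σ a) = τ a) (n : ℤ) :
    ∀ a : A, τ ((σ ^ n) a) = τ a := by
  induction n with
  | zero => simp
  | succ n ih => intro a; rw [zpow_add_one, AlgEquiv.mul_apply, ih, hτσ]
  | pred n ih =>
    intro a
    rw [zpow_sub_one, AlgEquiv.mul_apply, ih, ← hτσ, ← AlgEquiv.mul_apply, mul_inv_cancel,
      AlgEquiv.one_apply]

theorem trace_mul_map_derivation (hδ : ∀ a b : A, δ (a * b) = δ a * b + σ a * δ b)
    (hτδ : ∀ a : A, τ (δ a) = 0) (a b : A) : τ (σ a * δ b) = -τ (δ a * b) := by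
  have h := hτδ (a * b)
  rw [hδ, map_add] at h
  linear_combination h

theorem map_derivation (hδ : ∀ a b : A, δ (a * b) = δ a * b + σ a * δ b)
    (hτδ : ∀ a : A, τ (δ a) = 0) {b c : A} (h : TraceEquiv τ b c) :
    TraceEquiv τ (δ b) (δ c) := fun a => by
  obtain ⟨a, rfl⟩ := σ.surjective a
  rw [trace_mul_map_derivation hδ hτδ, trace_mul_map_derivation hδ hτδ, h]

theorem derivation_algEquiv (hδ : ∀ a b : A, δ (a * b) = δ a * b + σ a * δ b)
    (hτ : ∀ a b : A, τ (a * b) = τ (σ (σ b) * a)) (hτσ : ∀ a : A, τ (σ a) = τ a)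
    (hτδ : ∀ a : A, τ (δ a) = 0) (b : A) : TraceEquiv τ (δ (σ b)) (σ (δ b)) := fun a => by
  obtain ⟨b, rfl⟩ := σ.surjective b
  obtain ⟨a, rfl⟩ := σ.surjective a
  obtain ⟨a, rfl⟩ := σ.surjective a
  have h₁ := trace_mul_map_derivation hδ hτδ a (σ b)
  have h₂ := trace_mul_map_derivation hδ hτδ (σ (σ b)) a
  rw [← map_mul, hτσ, h₁, hτ (δ a), h₂, neg_neg, hτ (δ (σ (σ b)))]

theorem map_iterate {f : A → A} (hf : ∀ b c, TraceEquiv τ b c → TraceEquiv τ (f b) (f c))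
    (i : ℕ) {b c : A} (h : TraceEquiv τ b c) : TraceEquiv τ (f^[i] b) (f^[i] c) := by
  induction i with
  | zero => exact h
  | succ i ih => simpa only [iterate_succ_apply'] using hf _ _ ih

theorem zpow_comm (hτσ : ∀ a : A, τ (σ a) = τ a) {f : A → A}
    (hfσ : ∀ b, TraceEquiv τ (f (σ b)) (σ (f b))) (n : ℤ) :
    ∀ b : A, TraceEquiv τ (f ((σ ^ n) b)) ((σ ^ n) (f b)) := by
  induction n with
  | zero => exact fun _ => rfl
  | succ n ih =>
    intro b
    rw [zpow_add_one, AlgEquiv.mul_apply, AlgEquiv.mul_apply]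
    exact (ih (σ b)).trans (map_algEquiv (trace_zpow hτσ _) (hfσ b))
  | pred n ih =>
    intro b
    obtain ⟨b, rfl⟩ := σ.surjective b
    have h : ∀ x, (σ ^ (-(n : ℤ) - 1)) (σ x) = (σ ^ (-(n : ℤ))) x := fun x => by
      rw [← AlgEquiv.mul_apply, ← zpow_add_one, sub_add_cancel]
    have h' := map_algEquiv (trace_zpow hτσ (-(n : ℤ) - 1)) (hfσ b)
    rw [h] at h' ⊢
    exact (ih b).trans h'.symm

theorem iterate_zpow_comm (hτσ : ∀ a : A, τ (σ a) = τ a) {f : A → A}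
    (hf : ∀ b c, TraceEquiv τ b c → TraceEquiv τ (f b) (f c))
    (hfσ : ∀ b, TraceEquiv τ (f (σ b)) (σ (f b))) (i : ℕ) (n : ℤ) (b : A) :
    TraceEquiv τ (f^[i] ((σ ^ n) b)) ((σ ^ n) (f^[i] b)) := by
  induction i with
  | zero => exact rfl
  | succ i ih =>
    simp only [iterate_succ_apply']
    exact (hf _ _ ih).trans (zpow_comm hτσ hfσ n _)

end TraceEquiv

/-- used in Proposition 4.4. For two commuting `σ`-derivations
`δ₁, δ₂` and an invariant `σ²`-trace `τ`, the value
`τ (a ⬝ σ^{n₁}δ₁^{i₁}δ₂^{j₁} ⋯ σ^{n_r}δ₁^{i_r}δ₂^{j_r}(b))` depends only on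
`n₁+⋯+n_r`, `i₁+⋯+i_r` and `j₁+⋯+j_r`. -/
theorem trace_depends_only_on_sums
    {A : Type*} [Ring A] [Algebra ℂ A]
    (σ : A ≃ₐ[ℂ] A) (δ₁ δ₂ : A →ₗ[ℂ] A) (τ : A →ₗ[ℂ] ℂ)
    (hδ₁ : ∀ a b : A, δ₁ (a * b) = δ₁ a * b + σ a * δ₁ b)
    (hδ₂ : ∀ a b : A, δ₂ (a * b) = δ₂ a * b + σ a * δ₂ b)
    (hδcomm : ∀ a : A, δ₁ (δ₂ a) = δ₂ (δ₁ a))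
    (hτ : ∀ a b : A, τ (a * b) = τ (σ (σ b) * a))
    (hτσ : ∀ a : A, τ (σ a) = τ a)
    (hτδ₁ : ∀ a : A, τ (δ₁ a) = 0)
    (hτδ₂ : ∀ a : A, τ (δ₂ a) = 0) :
    ∀ (l : List (ℤ × ℕ × ℕ)) (a b : A),
      τ (a * mixComp σ (⇑δ₁) (⇑δ₂) l b)
        = τ (a * (σ ^ (l.map Prod.fst).sum)
              ((⇑δ₁)^[(l.map fun x => x.2.1).sum] ((⇑δ₂)^[(l.map fun x => x.2.2).sum] b))) := by
  have c₁ : ∀ b c, TraceEquiv τ b c → TraceEquiv τ (δ₁ b) (δ₁ c) :=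
    fun _ _ => TraceEquiv.map_derivation hδ₁ hτδ₁
  have c₂ : ∀ b c, TraceEquiv τ b c → TraceEquiv τ (δ₂ b) (δ₂ c) :=
    fun _ _ => TraceEquiv.map_derivation hδ₂ hτδ₂
  have s₁ := TraceEquiv.derivation_algEquiv hδ₁ hτ hτσ hτδ₁
  have s₂ := TraceEquiv.derivation_algEquiv hδ₂ hτ hτσ hτδ₂
  suffices H : ∀ (l : List (ℤ × ℕ × ℕ)) (b : A), TraceEquiv τ (mixComp σ δ₁ δ₂ l b)
      ((σ ^ (l.map Prod.fst).sum) (δ₁^[(l.map fun x => x.2.1).sum]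
        (δ₂^[(l.map fun x => x.2.2).sum] b))) from fun l a b => H l b a
  intro l b
  induction l with
  | nil => exact TraceEquiv.rfl
  | cons x t ih =>
    obtain ⟨n, i, j⟩ := x
    simp only [mixComp, comp_apply, List.map_cons, List.sum_cons, zpow_add, AlgEquiv.mul_apply,
      iterate_add_apply]
    have hcomm : Function.Commute δ₁ δ₂ := hδcomm
    rw [(hcomm.iterate_iterate (t.map fun x => x.2.1).sum j).eq]
    refine TraceEquiv.map_algEquiv (TraceEquiv.trace_zpow hτσ n) ?_
    refine TraceEquiv.trans ?_ (TraceEquiv.iterate_zpow_comm hτσ c₁ s₁ i _ _)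
    refine TraceEquiv.map_iterate c₁ i ?_
    exact (TraceEquiv.map_iterate c₂ j ih).trans (TraceEquiv.iterate_zpow_comm hτσ c₂ s₂ j _ _)
end

section
/- Let s ≥ 1 and k ≥ 0 be integers and α ∈ ℝ. Then ((−1)^{s−1}/s) · C(α−s, k) = Σ_{j=s}^{s+k} ((−1)^{j−1}/j) · C(α, s+k−j) · C(j, j−s), where for a real number x and a non-negative integer r, C(x, r) := x(x−1)⋯(x−r+1)/r! is the generalized binomial coefficient, and C(j, j−s) is the ordinary binomial coefficient. -/
/-- The generalized binomial coefficient `C(x, r) = x(x-1)⋯(x-r+1)/r!` for a real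
number `x` and a non-negative integer `r`, with `C(x, 0) = 1`. -/
noncomputable def genChoose (x : ℝ) (r : ℕ) : ℝ :=
  (∏ m ∈ Finset.range r, (x - m)) / r.factorial

theorem genChoose_eq_choose (x : ℝ) (r : ℕ) : genChoose x r = Ring.choose x r := by
  rw [genChoose, Ring.choose_eq_smul, ← Polynomial.aeval_eq_smeval,
    ← Polynomial.eval_map_algebraMap, descPochhammer_map,
    descPochhammer_eval_eq_prod_range, smul_eq_mul, div_eq_inv_mul]

theorem choose_neg_natCast_succ (n i : ℕ) :
    Ring.choose (-((n + 1 : ℕ) : ℝ)) i = (-1) ^ i * ((n + i).choose i : ℝ) := by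
  have h : ((n + 1 : ℕ) : ℝ) + i - 1 = ((n + i : ℕ) : ℝ) := by push_cast; ring
  rw [Ring.choose_neg, h, Ring.choose_natCast, Int.negOnePow_def, Units.smul_def, zsmul_eq_mul]
  simp

/-- Lemma 5.1. For integers `s ≥ 1`, `k ≥ 0` and `α ∈ ℝ`:
`((-1)^{s-1}/s) C(α-s, k) = ∑_{j=s}^{s+k} ((-1)^{j-1}/j) C(α, s+k-j) C(j, j-s)`. -/
theorem log_cocycle_binomial_identity (s k : ℕ) (hs : 1 ≤ s) (α : ℝ) :
    ((-1 : ℝ) ^ (s - 1) / (s : ℝ)) * genChoose (α - (s : ℝ)) k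
      = ∑ j ∈ Finset.Icc s (s + k),
          ((-1 : ℝ) ^ (j - 1) / (j : ℝ)) * genChoose α (s + k - j) * (j.choose (j - s) : ℝ) := by
  obtain ⟨n, rfl⟩ := Nat.exists_eq_add_of_le' hs
  have hIcc : Finset.Icc (n + 1) (n + 1 + k) = Finset.Ico (n + 1) (n + 1 + (k + 1)) := by
    ext; simp; omega
  rw [hIcc, Finset.sum_Ico_eq_sum_range, Nat.add_sub_cancel_left, genChoose_eq_choose,
    sub_eq_neg_add, Ring.add_choose_eq k (Commute.all _ _),
    Finset.Nat.sum_antidiagonal_eq_sum_range_succ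
      (fun i l => Ring.choose (-((n + 1 : ℕ) : ℝ)) i * Ring.choose α l), Finset.mul_sum]
  refine Finset.sum_congr rfl fun i _ => ?_
  have habs : ((n + 1 + i : ℕ) : ℝ) * ((n + i).choose i : ℝ)
      = ((n + 1 + i).choose i : ℝ) * ((n + 1 : ℕ) : ℝ) := by
    have h := Nat.add_one_mul_choose_eq (n + i) n
    rw [Nat.choose_symm_add, add_right_comm n i 1, Nat.choose_symm_add (a := n + 1)] at h
    exact_mod_cast h
  rw [choose_neg_natCast_succ, genChoose_eq_choose, Nat.add_sub_add_left,
    Nat.add_sub_cancel_left, Nat.add_sub_cancel, show n + 1 + i - 1 = n + i by omega, pow_add]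
  have h₁ : ((n + 1 : ℕ) : ℝ) ≠ 0 := by positivity
  have h₂ : ((n + 1 + i : ℕ) : ℝ) ≠ 0 := by positivity
  rw [div_mul_eq_mul_div, div_mul_eq_mul_div, div_mul_eq_mul_div, div_eq_div_iff h₁ h₂]
  linear_combination (-1) ^ n * (-1) ^ i * Ring.choose α (k - i) * habs
end
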